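/- Consider the sequences produced by Algorithm AGM-EF-1 (as specified in the context). Then for every k ≥ 0, J(x_k) ≤ q_k(z_k). -/

import Mathlib

noncomputable section

open scoped BigOperators

/-- Bregman divergence induced by `d`. -/
def breg {E : Type*} [NormedAddCommGroup E] [NormedSpace ℝ E]
    (d : E → ℝ) (x y : E) : ℝ :=
  d x - d y - fderiv ℝ d y (x - y)

/-- `d` is `σ`-strongly convex with respect to the norm `‖·‖`. -/
def StrongConvexOnNorm {E : Type*} [NormedAddCommGroup E] [NormedSpace ℝ E]
    (σ : ℝ) (d : E → ℝ) : Prop :=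
  ∀ x y : E, d x ≥ d y + fderiv ℝ d y (x - y) + σ / 2 * ‖x - y‖ ^ 2

/-- `g` is a subgradient of the extended-real-valued function `h` at `y`. -/
def IsSubgradE {E : Type*} [NormedAddCommGroup E] [NormedSpace ℝ E]
    (h : E → EReal) (y : E) (g : E →L[ℝ] ℝ) : Prop :=
  ∀ x, h x ≥ h y + ((g (x - y) : ℝ) : EReal)

/-- `h` is `lam`-strongly convex with respect to `d` (extended-real-valued version). -/
def ScWrtE {E : Type*} [NormedAddCommGroup E] [NormedSpace ℝ E]
    (d : E → ℝ) (lam : ℝ) (h : E → EReal) : Prop :=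
  ∀ y : E, h y ≠ ⊤ → ∀ g : E →L[ℝ] ℝ, IsSubgradE h y g →
    ∀ x, h x ≥ h y + ((g (x - y) + lam * breg d x y : ℝ) : EReal)

/-- `f` is `lam`-strongly convex with respect to `d` (real-valued version). -/
def ScWrtR {E : Type*} [NormedAddCommGroup E] [NormedSpace ℝ E]
    (d : E → ℝ) (lam : ℝ) (f : E → ℝ) : Prop :=
  ∀ y : E, ∀ g : E →L[ℝ] ℝ, (∀ x, f x ≥ f y + g (x - y)) →
    ∀ x, f x ≥ f y + g (x - y) + lam * breg d x y

/-- Convexity for extended-real-valued functions. -/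
def ConvexE {E : Type*} [NormedAddCommGroup E] [NormedSpace ℝ E]
    (h : E → EReal) : Prop :=
  ∀ x y : E, ∀ a b : ℝ, 0 ≤ a → 0 ≤ b → a + b = 1 →
    h (a • x + b • y) ≤ ((a : ℝ) : EReal) * h x + ((b : ℝ) : EReal) * h y

/-- The lower model `ℓ_f(x; y, lam1)`. -/
def ellf {E : Type*} [NormedAddCommGroup E] [NormedSpace ℝ E]
    (d : E → ℝ) (f : E → ℝ) (lam1 : ℝ) (x y : E) : ℝ :=
  f y + fderiv ℝ f y (x - y) + lam1 * breg d x y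


section AuxiliaryLemmas

variable {E : Type*} [NormedAddCommGroup E] [NormedSpace ℝ E]

lemma HasFDerivAt.le_apply_of_le_line {g : E → ℝ} {g' : E →L[ℝ] ℝ} {p v : E} {A : ℝ}
    (hg : HasFDerivAt g g' p)
    (h : ∀ t : ℝ, 0 < t → t ≤ 1 → g p + t * A ≤ g (p + t • v)) : A ≤ g' v := by
  have ht := (hg.hasLineDerivAt v).tendsto_slope_zero_right
  refine ge_of_tendsto ht ?_
  filter_upwards [Ioc_mem_nhdsGT (zero_lt_one' ℝ)] with t ht
  have h1 := h t ht.1 ht.2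
  rw [smul_eq_mul, ← div_eq_inv_mul, le_div_iff₀ ht.1]
  linarith

lemma ConvexOn.add_fderiv_le {f : E → ℝ} (hf : ConvexOn ℝ Set.univ f) {y : E}
    (hd : DifferentiableAt ℝ f y) (x : E) : f y + fderiv ℝ f y (x - y) ≤ f x := by
  have key : f y - f x ≤ (-fderiv ℝ f y) (x - y) := by
    refine HasFDerivAt.le_apply_of_le_line hd.hasFDerivAt.neg fun t ht0 ht1 => ?_
    have h := hf.2 (Set.mem_univ y) (Set.mem_univ x) (sub_nonneg.2 ht1) ht0.le (by ring)
    have e : y + t • (x - y) = (1 - t) • y + t • x := by module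
    rw [← e] at h
    simp only [smul_eq_mul, Pi.neg_apply] at h ⊢
    linarith
  simp only [neg_apply] at key
  linarith

lemma le_add_fderiv_add_sq_norm {f : E → ℝ} {L : ℝ} (hf : Differentiable ℝ f)
    (hL : ∀ x y : E, ‖fderiv ℝ f x - fderiv ℝ f y‖ ≤ L * ‖x - y‖) (x y : E) :
    f x ≤ f y + fderiv ℝ f y (x - y) + L / 2 * ‖x - y‖ ^ 2 := by
  have hder : ∀ t : ℝ, HasDerivAt
      (fun t : ℝ => f (y + t • (x - y)) - t * fderiv ℝ f y (x - y) - L / 2 * ‖x - y‖ ^ 2 * t ^ 2)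
      (fderiv ℝ f (y + t • (x - y)) (x - y) - fderiv ℝ f y (x - y) - L * ‖x - y‖ ^ 2 * t) t := by
    intro t
    have h1 : HasDerivAt (fun t : ℝ => y + t • (x - y)) (x - y) t := by
      simpa using ((hasDerivAt_id t).smul_const (x - y)).const_add y
    have h2 := (hf (y + t • (x - y))).hasFDerivAt.comp_hasDerivAt t h1
    have h3 := (hasDerivAt_id t).mul_const (fderiv ℝ f y (x - y))
    have h4 := (hasDerivAt_pow 2 t).const_mul (L / 2 * ‖x - y‖ ^ 2)
    refine ((h2.sub h3).sub h4).congr_deriv ?_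
    norm_num
    ring
  have hanti := antitoneOn_of_deriv_nonpos (convex_Icc (0 : ℝ) 1)
    (fun t _ => (hder t).continuousAt.continuousWithinAt)
    (fun t _ => (hder t).differentiableAt.differentiableWithinAt)
    (fun t ht => by
      rw [interior_Icc] at ht
      rw [(hder t).deriv]
      have h1 := (fderiv ℝ f (y + t • (x - y)) - fderiv ℝ f y).le_opNorm (x - y)
      have h2 := hL (y + t • (x - y)) y
      rw [add_sub_cancel_left, norm_smul, Real.norm_of_nonneg ht.1.le] at h2
      have h3 := mul_le_mul_of_nonneg_right h2 (norm_nonneg (x - y))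
      have h4 := (le_abs_self _).trans h1
      simp only [sub_apply] at h4
      nlinarith)
  have h := hanti (Set.left_mem_Icc.2 zero_le_one) (Set.right_mem_Icc.2 zero_le_one) zero_le_one
  simp only [one_smul, zero_smul, add_sub_cancel, add_zero] at h
  linarith

/-- Fermat's rule for the sum of a differentiable and a convex function. -/
lemma isSubgradE_neg_of_isMin {Ψ : E → EReal} (hbot : ∀ x, Ψ x ≠ ⊥) (hconv : ConvexE Ψ)
    {s : E → ℝ} {s' : E →L[ℝ] ℝ} {p : E} (hs : HasFDerivAt s s' p) (hp : Ψ p ≠ ⊤)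
    (hmin : ∀ w, (s p : EReal) + Ψ p ≤ (s w : EReal) + Ψ w) : IsSubgradE Ψ p (-s') := by
  intro w
  rcases eq_or_ne (Ψ w) ⊤ with hw | hw
  · simp [hw]
  have key : (Ψ p).toReal - (Ψ w).toReal ≤ s' (w - p) := by
    refine HasFDerivAt.le_apply_of_le_line hs fun t ht0 ht1 => ?_
    have h1 := hmin (p + t • (w - p))
    have h2 := hconv p w (1 - t) t (sub_nonneg.2 ht1) ht0.le (by ring)
    have e : p + t • (w - p) = (1 - t) • p + t • w := by module
    rw [← e] at h2
    have h3 := h1.trans (add_le_add le_rfl h2)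
    rw [← EReal.coe_toReal hp (hbot p), ← EReal.coe_toReal hw (hbot w)] at h3
    norm_cast at h3
    linarith
  rw [← EReal.coe_toReal hp (hbot p), ← EReal.coe_toReal hw (hbot w)]
  rw [ge_iff_le]
  norm_cast
  simp only [neg_apply]
  linarith

lemma hasFDerivAt_apply_sub (g : E →L[ℝ] ℝ) (y p : E) : HasFDerivAt (fun w => g (w - y)) g p := by
  simp only [map_sub]
  exact g.hasFDerivAt.sub_const (g y)

lemma hasFDerivAt_breg {d : E → ℝ} (hd : Differentiable ℝ d) (y p : E) :
    HasFDerivAt (fun w => breg d w y) (fderiv ℝ d p - fderiv ℝ d y) p := by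
  unfold breg
  exact ((hd p).hasFDerivAt.sub_const (d y)).sub (hasFDerivAt_apply_sub _ y p)

lemma StrongConvexOnNorm.sq_norm_le_breg {σ : ℝ} {d : E → ℝ} (hd : StrongConvexOnNorm σ d)
    (x y : E) : σ / 2 * ‖x - y‖ ^ 2 ≤ breg d x y := by
  have := hd x y
  unfold breg
  linarith

lemma breg_self (d : E → ℝ) (x : E) : breg d x x = 0 := by simp [breg]

/-- A convex lower semicontinuous function with an affine minorant has subgradients arbitrarily
close to each point `y` of its domain, pointing away from `y`. -/
lemma exists_isSubgradE_near [FiniteDimensional ℝ E] {σ : ℝ} (hσ : 0 < σ) {d : E → ℝ}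
    (hd : Differentiable ℝ d) (hdsc : StrongConvexOnNorm σ d)
    {Ψ : E → EReal} (hbot : ∀ x, Ψ x ≠ ⊥) (hlsc : LowerSemicontinuous Ψ) (hconv : ConvexE Ψ)
    {z : E} (hz : Ψ z ≠ ⊤) {g : E →L[ℝ] ℝ} (hg : IsSubgradE Ψ z g)
    {y : E} (hy : Ψ y ≠ ⊤) {ε : ℝ} (hε : 0 < ε) :
    ∃ p, p ∈ Metric.closedBall y ε ∧ Ψ p ≠ ⊤ ∧
      ∃ g' : E →L[ℝ] ℝ, IsSubgradE Ψ p g' ∧ 0 ≤ g' (y - p) := by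
  have : ProperSpace E := FiniteDimensional.proper ℝ E
  have hzr := EReal.coe_toReal hz (hbot z)
  have hyr := EReal.coe_toReal hy (hbot y)
  set B := (Ψ y).toReal - (Ψ z).toReal - g (y - z) with hB
  have hB0 : 0 ≤ B := by
    have h := hg y
    rw [← hzr, ← hyr, ge_iff_le] at h
    norm_cast at h
    linarith
  obtain ⟨n, hn0, hn⟩ : ∃ n : ℝ, 0 ≤ n ∧ n * (σ / 2) * ε = ‖g‖ + (B + 1) / ε :=
    ⟨(‖g‖ + (B + 1) / ε) / (σ / 2 * ε), by positivity, by field_simp⟩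
  have hcont : Continuous fun w => n * breg d w y :=
    continuous_const.mul
      (continuous_iff_continuousAt.2 fun w => (hasFDerivAt_breg hd y w).continuousAt)
  have hlsc' : LowerSemicontinuous fun w => ((n * breg d w y : ℝ) : EReal) + Ψ w := by
    refine LowerSemicontinuous.add'
      (continuous_coe_real_ereal.comp hcont).lowerSemicontinuous hlsc fun w => ?_
    exact EReal.continuousAt_add (Or.inl (EReal.coe_ne_top _)) (Or.inl (EReal.coe_ne_bot _))
  obtain ⟨p, hpB, hpmin⟩ := (hlsc'.lowerSemicontinuousOn _).exists_isMinOn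
    ⟨y, Metric.mem_closedBall_self hε.le⟩ (isCompact_closedBall y ε)
  have hpy : ((n * breg d p y : ℝ) : EReal) + Ψ p ≤ Ψ y := by
    simpa [breg_self] using hpmin (Metric.mem_closedBall_self hε.le)
  have hptop : Ψ p ≠ ⊤ := by
    intro h
    rw [h, EReal.coe_add_top] at hpy
    exact hy (top_le_iff.1 hpy)
  have hmin : ∀ w, ((n * breg d p y : ℝ) : EReal) + Ψ p ≤ ((n * breg d w y : ℝ) : EReal) + Ψ w := by
    intro w
    by_cases hw : w ∈ Metric.closedBall y ε
    · exact hpmin hw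
    refine hpy.trans ?_
    rcases eq_or_ne (Ψ w) ⊤ with hwt | hwt
    · rw [hwt, EReal.coe_add_top]
      exact le_top
    have hr : ε < ‖w - y‖ := by simpa [dist_eq_norm] using hw
    have h := hg w
    rw [← hzr, ← EReal.coe_toReal hwt (hbot w), ge_iff_le] at h
    rw [← hyr, ← EReal.coe_toReal hwt (hbot w)]
    norm_cast at h ⊢
    have h1 : g (w - z) = g (w - y) + g (y - z) := by rw [← map_add]; congr 1; abel
    have h2 : -(‖g‖ * ‖w - y‖) ≤ g (w - y) := (abs_le.1 (g.le_opNorm (w - y))).1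
    have h3 := mul_le_mul_of_nonneg_left (hdsc.sq_norm_le_breg w y) hn0
    have h4 : (‖g‖ + (B + 1) / ε) * ‖w - y‖ ≤ n * (σ / 2 * ‖w - y‖ ^ 2) := by
      rw [← hn]
      have : 0 ≤ n * (σ / 2) * ‖w - y‖ := by positivity
      nlinarith
    have h5 : B + 1 ≤ (B + 1) / ε * ‖w - y‖ := by
      rw [div_mul_eq_mul_div, le_div_iff₀ hε]
      nlinarith
    linarith
  refine ⟨p, hpB, hptop, _,
    isSubgradE_neg_of_isMin hbot hconv ((hasFDerivAt_breg hd y p).const_mul n) hptop hmin, ?_⟩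
  have h1 := hdsc p y
  have h2 := hdsc y p
  have h3 : fderiv ℝ d y (p - y) = -fderiv ℝ d y (y - p) := by rw [← map_neg, neg_sub]
  have h4 : 0 ≤ fderiv ℝ d y (y - p) - fderiv ℝ d p (y - p) := by
    have : 0 ≤ σ / 2 * ‖p - y‖ ^ 2 := by positivity
    have : 0 ≤ σ / 2 * ‖y - p‖ ^ 2 := by positivity
    linarith
  have := mul_nonneg hn0 h4
  simp only [neg_apply, smul_apply,
    sub_apply, smul_eq_mul]
  linarith

lemma mul_one_sub_mul_sq_norm_le {F : Type*} [SeminormedAddCommGroup F] {a : ℝ} (ha0 : 0 ≤ a) (ha1 : a ≤ 1) (x z p : F) :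
    a * (1 - a) * ‖x - z‖ ^ 2 ≤ (1 - a) * ‖x - p‖ ^ 2 + a * ‖z - p‖ ^ 2 := by
  have h1 : ‖x - z‖ ≤ ‖x - p‖ + ‖z - p‖ := by
    rw [norm_sub_rev z p]
    exact norm_sub_le_norm_sub_add_norm_sub x p z
  have h2 : ‖x - z‖ ^ 2 ≤ (‖x - p‖ + ‖z - p‖) ^ 2 := by gcongr
  have h3 := mul_le_mul_of_nonneg_left h2 (mul_nonneg ha0 (sub_nonneg.2 ha1))
  nlinarith [sq_nonneg ((1 - a) * ‖x - p‖ - a * ‖z - p‖)]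

/-- Strong convexity in Jensen form. -/
lemma ScWrtE.apply_add_le [FiniteDimensional ℝ E] {σ lam : ℝ} (hσ : 0 < σ) (hlam : 0 ≤ lam)
    {d : E → ℝ} (hd : Differentiable ℝ d) (hdsc : StrongConvexOnNorm σ d)
    {Ψ : E → EReal} (hbot : ∀ x, Ψ x ≠ ⊥) (hlsc : LowerSemicontinuous Ψ) (hconv : ConvexE Ψ)
    (hsc : ScWrtE d lam Ψ) {z₀ : E} (hz₀ : Ψ z₀ ≠ ⊤) {g : E →L[ℝ] ℝ} (hg : IsSubgradE Ψ z₀ g)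
    {x z : E} {rx rz a : ℝ} (hx : Ψ x = rx) (hz : Ψ z = rz) (ha0 : 0 ≤ a) (ha1 : a ≤ 1) :
    Ψ ((1 - a) • x + a • z) ≤
      (((1 - a) * rx + a * rz - lam * (σ / 2) * (a * (1 - a) * ‖x - z‖ ^ 2) : ℝ) : EReal) := by
  set y := (1 - a) • x + a • z with hy
  set R := (1 - a) * rx + a * rz - lam * (σ / 2) * (a * (1 - a) * ‖x - z‖ ^ 2) with hR
  have hytop : Ψ y ≠ ⊤ := by
    have h := hconv x z (1 - a) a (sub_nonneg.2 ha1) ha0 (by ring)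
    rw [hx, hz] at h
    intro ht
    rw [← hy, ht] at h
    exact EReal.coe_ne_top _ (top_le_iff.1 h)
  by_contra! hlt
  obtain ⟨ε, hε, hball⟩ := Metric.nhds_basis_closedBall.eventually_iff.1 (hlsc y _ hlt)
  obtain ⟨p, hpB, hptop, g', hg', hpos⟩ :=
    exists_isSubgradE_near hσ hd hdsc hbot hlsc hconv hz₀ hg hytop hε
  have hRp : (R : EReal) < Ψ p := hball hpB
  have h1 := hsc p hptop g' hg' x
  have h2 := hsc p hptop g' hg' z
  rw [← EReal.coe_toReal hptop (hbot p)] at hRp h1 h2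
  rw [hx, ge_iff_le] at h1
  rw [hz, ge_iff_le] at h2
  norm_cast at hRp h1 h2
  have h3 : g' (y - p) = (1 - a) * g' (x - p) + a * g' (z - p) := by
    rw [← smul_eq_mul, ← smul_eq_mul, ← map_smul, ← map_smul, ← map_add, hy]
    congr 1
    module
  have h4 := mul_le_mul_of_nonneg_left (mul_one_sub_mul_sq_norm_le ha0 ha1 x z p)
    (by positivity : 0 ≤ lam * (σ / 2))
  have h5 := mul_le_mul_of_nonneg_left (hdsc.sq_norm_le_breg x p)
    (mul_nonneg hlam (sub_nonneg.2 ha1))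
  have h6 := mul_le_mul_of_nonneg_left (hdsc.sq_norm_le_breg z p) (mul_nonneg hlam ha0)
  have h7 := mul_le_mul_of_nonneg_left h1 (sub_nonneg.2 ha1)
  have h8 := mul_le_mul_of_nonneg_left h2 ha0
  nlinarith

lemma mul_sq_norm_add_le {t₁ t₂ t₃ : ℝ} (h₁ : 0 ≤ t₁) (h₂ : 0 ≤ t₂) (h₃ : 0 ≤ t₃) (x y z : E) :
    ‖t₁ • x + t₂ • y + t₃ • z‖ ^ 2 ≤
      (t₁ + t₂ + t₃) * (t₁ * ‖x‖ ^ 2 + t₂ * ‖y‖ ^ 2 + t₃ * ‖z‖ ^ 2) := by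
  have h : ‖t₁ • x + t₂ • y + t₃ • z‖ ≤ t₁ * ‖x‖ + t₂ * ‖y‖ + t₃ * ‖z‖ := by
    refine norm_add₃_le.trans_eq ?_
    simp [norm_smul, abs_of_nonneg, h₁, h₂, h₃]
  have h' : ‖t₁ • x + t₂ • y + t₃ • z‖ ^ 2 ≤ (t₁ * ‖x‖ + t₂ * ‖y‖ + t₃ * ‖z‖) ^ 2 := by gcongr
  nlinarith [mul_nonneg (mul_nonneg h₁ h₂) (sq_nonneg (‖x‖ - ‖y‖)),
    mul_nonneg (mul_nonneg h₁ h₃) (sq_nonneg (‖x‖ - ‖z‖)),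
    mul_nonneg (mul_nonneg h₂ h₃) (sq_nonneg (‖y‖ - ‖z‖))]

/-- The choice of the extrapolated point `u` and the step `a` balances the quadratic terms. -/
lemma mul_sq_norm_step_le {σ lam1 lam2 L a c : ℝ} (hσ : 0 < σ) (hlam1 : 0 ≤ lam1)
    (hlam2 : 0 ≤ lam2) (hc : 0 < c) (ha0 : 0 < a) (ha1 : a < 1)
    (hroot : σ * (1 - a) * (c + lam2 * a) + σ * lam1 * a = L * a ^ 2) {x z u : E}
    (hu : u = ((((1 - a) * c + lam1 * a + lam2 * a * (1 - a)) - lam1 * a * a)⁻¹) •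
          (((((1 - a) * c + lam1 * a + lam2 * a * (1 - a))
                - ((1 - a) * c + lam1 * a) * a) • x) + (((1 - a) * c * a) • z))) (w : E) :
    L * ‖(1 - a) • x + a • w - u‖ ^ 2 ≤
      σ * ((1 - a) * c * ‖w - z‖ ^ 2 + lam1 * a * ‖w - u‖ ^ 2
        + lam2 * a * (1 - a) * ‖w - x‖ ^ 2) := by
  have h1a : 0 < 1 - a := sub_pos.2 ha1
  set t₁ := (1 - a) * c with ht₁
  set t₂ := lam1 * a with ht₂
  set t₃ := lam2 * a * (1 - a) with ht₃
  have p₁ : 0 < t₁ := by positivity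
  have p₂ : 0 ≤ t₂ := by positivity
  have p₃ : 0 ≤ t₃ := by positivity
  have hτ : σ * (t₁ + t₂ + t₃) = L * a ^ 2 := by rw [← hroot, ht₁, ht₂, ht₃]; ring
  have hden : 0 < t₁ + t₂ + t₃ - t₂ * a := by nlinarith
  have hu' : (t₁ + t₂ + t₃ - t₂ * a) • u =
      (t₁ + t₂ + t₃ - (t₁ + t₂) * a) • x + (t₁ * a) • z := by
    rw [hu, smul_inv_smul₀ hden.ne']
  have hvec : (t₁ + t₂ + t₃) • ((1 - a) • x + a • w - u) =
      a • (t₁ • (w - z) + t₂ • (w - u) + t₃ • (w - x)) := by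
    have e : (t₁ + t₂ + t₃) • u = (t₁ + t₂ + t₃ - t₂ * a) • u + (t₂ * a) • u := by module
    rw [smul_sub, e, hu']
    module
  set v := (1 - a) • x + a • w - u
  set τ := t₁ + t₂ + t₃ with hτdef
  have hτpos : 0 < τ := by positivity
  have hn : τ ^ 2 * ‖v‖ ^ 2 = a ^ 2 * ‖t₁ • (w - z) + t₂ • (w - u) + t₃ • (w - x)‖ ^ 2 := by
    have := congrArg (fun y => ‖y‖ ^ 2) hvec
    simpa only [norm_smul, mul_pow, Real.norm_eq_abs, sq_abs] using this
  have hm := mul_sq_norm_add_le p₁.le p₂ p₃ (w - z) (w - u) (w - x)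
  set Q := t₁ * ‖w - z‖ ^ 2 + t₂ * ‖w - u‖ ^ 2 + t₃ * ‖w - x‖ ^ 2
  have h1 : τ * (τ * ‖v‖ ^ 2) ≤ τ * (a ^ 2 * Q) := by
    calc τ * (τ * ‖v‖ ^ 2) = τ ^ 2 * ‖v‖ ^ 2 := by ring
      _ ≤ a ^ 2 * (τ * Q) := by rw [hn]; gcongr
      _ = τ * (a ^ 2 * Q) := by ring
  have h2 := mul_le_mul_of_nonneg_left (le_of_mul_le_mul_left h1 hτpos) hσ.le
  have h3 : a ^ 2 * (L * ‖v‖ ^ 2) ≤ a ^ 2 * (σ * Q) := by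
    calc a ^ 2 * (L * ‖v‖ ^ 2) = σ * τ * ‖v‖ ^ 2 := by rw [hτ]; ring
      _ ≤ a ^ 2 * (σ * Q) := by linarith
  exact le_of_mul_le_mul_left h3 (by positivity)

end AuxiliaryLemmas

/-- in AGM-EF-1, `J(x_k) ≤ q_k(z_k)` for every `k ≥ 0`. -/
theorem stmt13 {E : Type*} [NormedAddCommGroup E] [NormedSpace ℝ E] [FiniteDimensional ℝ E]
    (σ lam1 lam2 L : ℝ) (hσ : 0 < σ) (hlam1 : 0 ≤ lam1) (hlam2 : 0 ≤ lam2)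
    (hL : σ * lam1 < L)
    (d : E → ℝ) (hddiff : Differentiable ℝ d) (hdconv : ConvexOn ℝ Set.univ d)
    (hdsc : StrongConvexOnNorm σ d)
    (Ψ : E → EReal) (hΨbot : ∀ x, Ψ x ≠ ⊥) (hΨprop : ∃ x, Ψ x ≠ ⊤)
    (hΨlsc : LowerSemicontinuous Ψ) (hΨconv : ConvexE Ψ) (hΨsc : ScWrtE d lam2 Ψ)
    (f : E → ℝ) (hfconv : ConvexOn ℝ Set.univ f) (hfdiff : Differentiable ℝ f)
    (hfsc : ScWrtR d lam1 f)
    (hfL : ∀ x y : E, ‖fderiv ℝ f x - fderiv ℝ f y‖ ≤ L * ‖x - y‖)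
    -- Algorithm AGM-EF-1
    (x z u : ℕ → E) (a c : ℕ → ℝ) (ψ q : ℕ → E → EReal)
    (hu0 : Ψ (u 0) ≠ ⊤) (hc0 : c 0 = L / σ + lam2)
    (hq0 : ∀ w, q 0 w =
      ((L / σ * breg d w (u 0) + f (u 0) + fderiv ℝ f (u 0) (w - u 0) : ℝ) : EReal) + Ψ w)
    (hx0 : x 0 = z 0) (hz0min : ∀ w, q 0 (z 0) ≤ q 0 w)
    (hamem : ∀ k, a (k + 1) ∈ Set.Ioo (0 : ℝ) 1)
    (haroot : ∀ k, σ * (1 - a (k + 1)) * (c k + lam2 * a (k + 1)) + σ * lam1 * a (k + 1)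
        = L * a (k + 1) ^ 2)
    (hc : ∀ k, c (k + 1) = (1 - a (k + 1)) * c k + (lam1 + lam2) * a (k + 1))
    (hu : ∀ k,
      u (k + 1) =
        ((((1 - a (k + 1)) * c k + lam1 * a (k + 1) + lam2 * a (k + 1) * (1 - a (k + 1)))
            - lam1 * a (k + 1) * a (k + 1))⁻¹) •
          (((((1 - a (k + 1)) * c k + lam1 * a (k + 1) + lam2 * a (k + 1) * (1 - a (k + 1)))
                - ((1 - a (k + 1)) * c k + lam1 * a (k + 1)) * a (k + 1)) • x k)
            + (((1 - a (k + 1)) * c k * a (k + 1)) • z k)))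
    (hψ : ∀ k w, ψ (k + 1) w =
      ((1 - a (k + 1) : ℝ) : EReal) * q k w
        + ((a (k + 1) : ℝ) : EReal) * (((ellf d f lam1 w (u (k + 1)) : ℝ) : EReal) + Ψ w))
    (hz : ∀ k w, ψ (k + 1) (z (k + 1)) ≤ ψ (k + 1) w)
    (hx : ∀ k, x (k + 1) = (1 - a (k + 1)) • x k + a (k + 1) • z (k + 1))
    (hq : ∀ k w, q (k + 1) w =
      ((c (k + 1) * breg d w (z (k + 1)) : ℝ) : EReal) + ψ (k + 1) (z (k + 1)))
    :
    ∀ k : ℕ, ((f (x k) : ℝ) : EReal) + Ψ (x k) ≤ q k (z k) := by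
  have hLpos : 0 < L := (mul_nonneg hσ.le hlam1).trans_lt hL
  have hz0top : Ψ (z 0) ≠ ⊤ := by
    intro h
    have h1 := hz0min (u 0)
    rw [hq0, hq0, h, EReal.coe_add_top, ← EReal.coe_toReal hu0 (hΨbot _), ← EReal.coe_add] at h1
    exact EReal.coe_ne_top _ (top_le_iff.1 h1)
  have hz0r := EReal.coe_toReal hz0top (hΨbot (z 0))
  have hcpos : ∀ k, 0 < c k := by
    intro k
    induction k with
    | zero => rw [hc0]; positivity
    | succ k ih =>
      rw [hc]
      have h0 := (hamem k).1
      have h1 := sub_pos.2 (hamem k).2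
      positivity
  have hder : HasFDerivAt
      (fun w => L / σ * breg d w (u 0) + f (u 0) + fderiv ℝ f (u 0) (w - u 0))
      ((L / σ) • (fderiv ℝ d (z 0) - fderiv ℝ d (u 0)) + fderiv ℝ f (u 0)) (z 0) := by
    exact (((hasFDerivAt_breg hddiff (u 0) (z 0)).const_mul (L / σ)).add_const (f (u 0))).add
      (hasFDerivAt_apply_sub _ (u 0) (z 0))
  have hg := isSubgradE_neg_of_isMin hΨbot hΨconv hder hz0top
    (fun w => by rw [← hq0, ← hq0]; exact hz0min w)
  have hgrowth : ∀ k w, ((c k * breg d w (z k) : ℝ) : EReal) + q k (z k) ≤ q k w := by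
    intro k w
    cases k with
    | succ k => simp [hq, breg_self]
    | zero =>
      rcases eq_or_ne (Ψ w) ⊤ with hw | hw
      · rw [hq0 w, hw, EReal.coe_add_top]
        exact le_top
      have h := hΨsc _ hz0top _ hg w
      rw [hq0, hq0, hc0]
      rw [← hz0r, ← EReal.coe_toReal hw (hΨbot w)] at h ⊢
      rw [ge_iff_le] at h
      norm_cast at h ⊢
      simp only [breg, neg_apply, add_apply,
        smul_apply, sub_apply, smul_eq_mul, map_sub] at h ⊢
      linarith
  intro k
  induction k with
  | zero =>
    rw [hx0, hq0]
    refine add_le_add (EReal.coe_le_coe_iff.2 ?_) le_rfl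
    have h1 := le_add_fderiv_add_sq_norm hfdiff hfL (z 0) (u 0)
    have h2 := mul_le_mul_of_nonneg_left (hdsc.sq_norm_le_breg (z 0) (u 0))
      (div_nonneg hLpos.le hσ.le)
    have h3 : L / σ * (σ / 2 * ‖z 0 - u 0‖ ^ 2) = L / 2 * ‖z 0 - u 0‖ ^ 2 := by field_simp
    linarith
  | succ k ih =>
    have ha0 := (hamem k).1
    have h1a := sub_pos.2 (hamem k).2
    have hqk : ((c k * breg d (z (k + 1)) (z k) + f (x k) : ℝ) : EReal) + Ψ (x k)
        ≤ q k (z (k + 1)) := by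
      refine le_trans ?_ (hgrowth k (z (k + 1)))
      rw [EReal.coe_add, add_assoc]
      exact add_le_add le_rfl ih
    have hlow : ((1 - a (k + 1) : ℝ) : EReal) *
          (((c k * breg d (z (k + 1)) (z k) + f (x k) : ℝ) : EReal) + Ψ (x k))
        + ((a (k + 1) : ℝ) : EReal) *
          (((ellf d f lam1 (z (k + 1)) (u (k + 1)) : ℝ) : EReal) + Ψ (z (k + 1)))
        ≤ q (k + 1) (z (k + 1)) := by
      rw [hq, breg_self, mul_zero, EReal.coe_zero, zero_add, hψ]
      exact add_le_add (mul_le_mul_of_nonneg_left hqk (EReal.coe_nonneg.2 h1a.le)) le_rfl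
    refine le_trans ?_ hlow
    rcases eq_or_ne (Ψ (z (k + 1))) ⊤ with hzt | hzt
    · rw [hzt, EReal.coe_add_top, EReal.coe_mul_top_of_pos ha0]
      rw [EReal.add_top_of_ne_bot]
      · exact le_top
      rcases eq_or_ne (Ψ (x k)) ⊤ with hxt | hxt
      · rw [hxt, EReal.coe_add_top, EReal.coe_mul_top_of_pos h1a]
        exact top_ne_bot
      · rw [← EReal.coe_toReal hxt (hΨbot _), ← EReal.coe_add, ← EReal.coe_mul]
        exact EReal.coe_ne_bot _
    obtain ⟨rz, hzr⟩ : ∃ r : ℝ, Ψ (z (k + 1)) = r := ⟨_, (EReal.coe_toReal hzt (hΨbot _)).symm⟩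
    rcases eq_or_ne (Ψ (x k)) ⊤ with hxt | hxt
    · rw [hxt, EReal.coe_add_top, EReal.coe_mul_top_of_pos h1a, hzr, ← EReal.coe_add,
        ← EReal.coe_mul, EReal.top_add_coe]
      exact le_top
    obtain ⟨rx, hxr⟩ : ∃ r : ℝ, Ψ (x k) = r := ⟨_, (EReal.coe_toReal hxt (hΨbot _)).symm⟩
    have hΨx := hΨsc.apply_add_le hσ hlam2 hddiff hdsc hΨbot hΨlsc hΨconv hz0top hg hxr hzr
      ha0.le (hamem k).2.le
    rw [← hx] at hΨx
    refine (add_le_add le_rfl hΨx).trans ?_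
    rw [hxr, hzr]
    norm_cast
    have hdescent := le_add_fderiv_add_sq_norm hfdiff hfL (x (k + 1)) (u (k + 1))
    have hfx := hfsc (u (k + 1)) _ (fun w => hfconv.add_fderiv_le (hfdiff _) w) (x k)
    have hstep := mul_sq_norm_step_le hσ hlam1 hlam2 (hcpos k) ha0 (hamem k).2 (haroot k) (hu k)
      (z (k + 1))
    rw [← hx] at hstep
    have hlin : fderiv ℝ f (u (k + 1)) (x (k + 1) - u (k + 1)) =
        (1 - a (k + 1)) * fderiv ℝ f (u (k + 1)) (x k - u (k + 1)) +
          a (k + 1) * fderiv ℝ f (u (k + 1)) (z (k + 1) - u (k + 1)) := by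
      rw [← smul_eq_mul, ← smul_eq_mul, ← map_smul, ← map_smul, ← map_add, hx]
      congr 1
      module
    have hb1 := mul_le_mul_of_nonneg_left (hdsc.sq_norm_le_breg (z (k + 1)) (z k))
      (mul_nonneg h1a.le (hcpos k).le)
    have hb2 := mul_le_mul_of_nonneg_left (hdsc.sq_norm_le_breg (z (k + 1)) (u (k + 1)))
      (mul_nonneg hlam1 ha0.le)
    have hb3 : 0 ≤ lam1 * breg d (x k) (u (k + 1)) :=
      mul_nonneg hlam1 (le_trans (by positivity) (hdsc.sq_norm_le_breg (x k) (u (k + 1))))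
    have hfx' : f (u (k + 1)) + fderiv ℝ f (u (k + 1)) (x k - u (k + 1)) ≤ f (x k) := by linarith
    have hfx'' := mul_le_mul_of_nonneg_left hfx' h1a.le
    rw [norm_sub_rev (z (k + 1)) (x k)] at hstep
    unfold ellf
    linarith
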